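/- arXiv:1302.6627 — 9 statements merged into one kernel-verified Lean document; each statement's English description precedes it below -/
import Mathlib

section
/- Let N be a nilpotent 2n×2n complex matrix satisfying Nᵀ·J + J·N = 0, where J = [[0, Iₙ],[−Iₙ, 0]] is the standard symplectic matrix (i.e., N lies in the Lie algebra sp(2n,ℂ)). Then for every odd integer r ≥ 1, the integer rank(N^{r−1}) − 2·rank(N^r) + rank(N^{r+1}) is even. Equivalently, every odd part of the Jordan type of N occurs with even multiplicity. -/
/-- A skew-symmetric matrix over a field of characteristic not two has even rank. -/
theorem Matrix.even_rank_of_transpose_eq_neg {K m : Type*} [Field K] [NeZero (2 : K)]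
    [Fintype m] [DecidableEq m] (A : Matrix m m K) (hA : A.transpose = -A) : Even A.rank := by
  set B : LinearMap.BilinForm K (m → K) := Matrix.toBilin' A with hB
  have hskew : ∀ x y, B x y = -B y x := by
    intro x y
    rw [hB, Matrix.toBilin'_apply', Matrix.toBilin'_apply', Matrix.dotProduct_mulVec,
      ← Matrix.mulVec_transpose, hA, Matrix.neg_mulVec, neg_dotProduct, dotProduct_comm]
  have hker : LinearMap.ker B = LinearMap.ker A.mulVecLin := by
    ext x
    simp only [LinearMap.mem_ker, Matrix.mulVecLin_apply]
    constructor
    · intro h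
      refine dotProduct_eq_zero _ fun y => ?_
      have : B y x = 0 := by rw [hskew, h]; simp
      rwa [hB, Matrix.toBilin'_apply', dotProduct_comm] at this
    · intro h
      refine LinearMap.ext fun y => ?_
      rw [hskew, hB, Matrix.toBilin'_apply', h, dotProduct_zero, neg_zero, LinearMap.zero_apply]
  obtain ⟨W, hW⟩ := (LinearMap.ker B).exists_isCompl
  have hrefl : B.IsRefl := fun x y h => by rw [hskew, h, neg_zero]
  have hnd : (B.restrict W).Nondegenerate := by
    have hreflW : (B.restrict W).IsRefl := fun x y => hrefl x y
    refine (LinearMap.IsRefl.nondegenerate_iff_separatingLeft hreflW).2 fun x hx => ?_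
    have hxker : (x : m → K) ∈ LinearMap.ker B := by
      refine LinearMap.mem_ker.2 (LinearMap.ext fun y => ?_)
      obtain ⟨k, hk, w, hw, rfl⟩ := Submodule.mem_sup.1 (hW.sup_eq_top ▸ Submodule.mem_top (x := y))
      have hxw : B x w = 0 := hx ⟨w, hw⟩
      rw [map_add, hskew, LinearMap.mem_ker.1 hk, hxw]
      simp
    exact Subtype.ext (Submodule.disjoint_def.1 hW.disjoint _ hxker x.2)
  have hrank : A.rank = Module.finrank K W := by
    have h1 := A.mulVecLin.finrank_range_add_finrank_ker
    have h2 := Submodule.finrank_add_eq_of_isCompl hW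
    rw [hker] at h2
    unfold Matrix.rank
    omega
  rw [hrank]
  let b := Module.finBasis K W
  have hdet := (LinearMap.BilinForm.nondegenerate_iff_det_ne_zero b).1 hnd
  by_contra hodd
  rw [Nat.not_even_iff_odd] at hodd
  apply hdet
  set M := LinearMap.BilinForm.toMatrix b (B.restrict W)
  have hM : M.transpose = -M := by
    ext i j
    simp [M, LinearMap.BilinForm.toMatrix_apply, hskew (b j : m → K)]
  have h := M.det_transpose
  rw [hM, Matrix.det_neg, Fintype.card_fin, hodd.neg_one_pow, neg_one_mul] at h
  have h2 : (2 : K) * M.det = 0 := by linear_combination -h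
  exact (mul_eq_zero.1 h2).resolve_left two_ne_zero

/-- If `Nᵀ J = -J N` with `J` skew-symmetric and invertible, then even powers of `N` have
even rank, because `J N ^ (2 k)` is skew-symmetric. -/
theorem Matrix.even_rank_pow_of_transpose_mul {K m : Type*} [Field K] [NeZero (2 : K)]
    [Fintype m] [DecidableEq m] (J N : Matrix m m K) (hJ : J.transpose = -J)
    (hdet : IsUnit J.det) (h : N.transpose * J = -(J * N)) {k : ℕ} (hk : Even k) :
    Even (N ^ k).rank := by
  rw [← Matrix.rank_mul_eq_right_of_isUnit_det J (N ^ k) hdet]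
  apply Matrix.even_rank_of_transpose_eq_neg
  have hs : SemiconjBy J (-N) N.transpose := by
    simp [SemiconjBy, h]
  have hp := (hs.pow_right k).eq
  rw [hk.neg_pow] at hp
  rw [Matrix.transpose_mul, Matrix.transpose_pow, hJ, mul_neg, hp]

/-- For a nilpotent `N ∈ sp(2n, ℂ)` (i.e. `Nᵀ J + J N = 0` for the standard
symplectic matrix `J`), and every odd `r ≥ 1`, the integer
`rank(N^(r-1)) − 2 rank(N^r) + rank(N^(r+1))` is even. -/
theorem sp_nilpotent_odd_parts_even_multiplicity
    (n : ℕ) (N : Matrix (Fin n ⊕ Fin n) (Fin n ⊕ Fin n) ℂ)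
    (hnil : IsNilpotent N)
    (hsp : N.transpose * Matrix.fromBlocks 0 1 (-1) 0 +
        Matrix.fromBlocks 0 1 (-1) 0 * N = 0) :
    ∀ r : ℕ, Odd r → 1 ≤ r →
      Even (((N ^ (r - 1)).rank : ℤ) - 2 * ((N ^ r).rank : ℤ) + ((N ^ (r + 1)).rank : ℤ)) := by
  intro r hr _
  have key {k : ℕ} (hk : Even k) : Even ((N ^ k).rank : ℤ) := by
    refine (Int.even_coe_nat _).2 (Matrix.even_rank_pow_of_transpose_mul
      (Matrix.fromBlocks 0 1 (-1) 0) N ?_ ?_ (eq_neg_of_add_eq_zero_left hsp) hk)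
    · simp [Matrix.fromBlocks_transpose, Matrix.fromBlocks_neg]
    · refine (Matrix.isUnit_iff_isUnit_det _).1
        (IsUnit.of_mul_eq_one (Matrix.fromBlocks 0 (-1) 1 0) ?_)
      simp [Matrix.fromBlocks_multiply]
  exact ((key (Nat.Odd.sub_odd hr odd_one)).sub (even_two_mul _)).add (key hr.add_one)
end

section
/- Let λ = (λ₁ ≥ λ₂ ≥ …) be a partition of 2n in which every odd part occurs with even multiplicity. Then there exists a nilpotent 2n×2n complex matrix N with Nᵀ·J + J·N = 0 (where J = [[0, Iₙ],[−Iₙ, 0]]) such that rank(N^r) = Σ_i max(λ_i − r, 0) for every r ≥ 0; that is, λ is the Jordan type of a nilpotent element of sp(2n,ℂ). -/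
open Matrix

section Rank

variable {K : Type*} [Field K] {m n : Type*} [Fintype m] [Fintype n]

theorem Matrix.rank_fromBlocks_diagonal (A : Matrix m m K) (D : Matrix n n K) :
    (fromBlocks A 0 0 D).rank = A.rank + D.rank := by
  let e := LinearEquiv.sumArrowLequivProdArrow m n K K
  have h : (fromBlocks A 0 0 D).mulVecLin =
      e.symm.toLinearMap ∘ₗ (A.mulVecLin.prodMap D.mulVecLin) ∘ₗ e.toLinearMap := by
    refine LinearMap.ext fun x => funext fun i => ?_
    cases i <;> simp [e, fromBlocks_mulVec] <;> rfl
  have hprod : Module.finrank K (LinearMap.range (A.mulVecLin.prodMap D.mulVecLin)) =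
      A.rank + D.rank := by
    let f := (LinearMap.range A.mulVecLin).subtype.prodMap (LinearMap.range D.mulVecLin).subtype
    have hf : Function.Injective f :=
      Function.Injective.prodMap (Submodule.subtype_injective _) (Submodule.subtype_injective _)
    have hrange : LinearMap.range (A.mulVecLin.prodMap D.mulVecLin) = LinearMap.range f := by
      simp only [f, LinearMap.range_prodMap, Submodule.range_subtype]
    rw [hrange, LinearMap.finrank_range_of_inj hf, Module.finrank_prod, Matrix.rank, Matrix.rank]
  rw [Matrix.rank, h, LinearMap.range_comp, LinearMap.range_comp, LinearEquiv.range,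
    Submodule.map_top, ← hprod]
  exact LinearEquiv.finrank_map_eq e.symm _

end Rank

theorem Matrix.eq_zero_of_rank_eq_zero {K m n : Type*} [Field K] [Fintype n]
    {A : Matrix m n K} (h : A.rank = 0) : A = 0 := by
  classical
  rw [Matrix.rank, Submodule.finrank_eq_zero, LinearMap.range_eq_bot] at h
  ext i j
  simpa using congrFun (LinearMap.congr_fun h (Pi.single j 1)) i

section SignedShift

variable {ι : Type*} [Fintype ι] {m : ℕ}

/-- The shift by `r` along the string `p`, conjugated by the diagonal matrix of signs `g`. -/
def signedShift (p : ι ≃ Fin m) (g : ι → ℂ) (r : ℕ) : Matrix ι ι ℂ :=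
  of fun x y => if (p x : ℕ) = p y + r then g x * g y else 0

variable {p : ι ≃ Fin m} {g : ι → ℂ}

theorem signedShift_mul_one (hg : ∀ x, g x * g x = 1) (r : ℕ) :
    signedShift p g r * signedShift p g 1 = signedShift p g (r + 1) := by
  ext x y
  simp only [signedShift, mul_apply, of_apply]
  by_cases hy : (p y : ℕ) + 1 < m
  · have hz (z : ι) : (p z : ℕ) = p y + 1 ↔ z = p.symm ⟨p y + 1, hy⟩ := by
      rw [Equiv.eq_symm_apply, Fin.ext_iff]
    classical
    simp only [hz, mul_ite, mul_zero, Finset.sum_ite_eq', Finset.mem_univ, if_true,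
      Equiv.apply_symm_apply, ite_mul, zero_mul]
    refine if_congr (by omega) ?_ rfl
    linear_combination g x * g y * hg (p.symm ⟨p y + 1, hy⟩)
  · rw [if_neg (by have := (p x).isLt; omega)]
    refine Finset.sum_eq_zero fun z _ => ?_
    rw [if_neg (c := (p z : ℕ) = p y + 1) (by have := (p z).isLt; omega), mul_zero]

theorem signedShift_pow [DecidableEq ι] (hg : ∀ x, g x * g x = 1) (r : ℕ) :
    signedShift p g 1 ^ r = signedShift p g r := by
  induction r with
  | zero =>
    ext x y
    by_cases h : x = y
    · simp [signedShift, h, hg]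
    · simp [signedShift, h, Fin.val_inj]
  | succ r ih => rw [pow_succ, ih, signedShift_mul_one hg]

open scoped ComplexOrder in
theorem rank_signedShift (hg : ∀ x, g x * g x = 1) (r : ℕ) :
    (signedShift p g r).rank = m - r := by
  classical
  have hg0 (x : ι) : g x ≠ 0 := fun h => by simpa [h] using hg x
  have hdiag : signedShift p g r * (signedShift p g r)ᴴ =
      diagonal fun x => if r ≤ (p x : ℕ) then (g x * star (g x)) else 0 := by
    ext x y
    simp only [signedShift, mul_apply, conjTranspose_apply, of_apply, diagonal_apply]
    by_cases hx : r ≤ (p x : ℕ)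
    · have hz (z : ι) : (p x : ℕ) = p z + r ↔
          z = p.symm ⟨p x - r, by have := (p x).isLt; omega⟩ := by
        rw [Equiv.eq_symm_apply, Fin.ext_iff]
        simp only
        omega
      simp only [hz, ite_mul, zero_mul, Finset.sum_ite_eq', Finset.mem_univ, if_true,
        Equiv.apply_symm_apply, if_pos hx]
      by_cases hxy : x = y
      · subst hxy
        rw [if_pos (by omega), if_pos rfl, star_mul']
        have h := hg (p.symm ⟨p x - r, by have := (p x).isLt; omega⟩)
        have h' := congrArg star h
        rw [star_mul', star_one] at h'
        generalize g (p.symm _) = a at h h' ⊢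
        have ha : a * star a = 1 := by
          rcases mul_self_eq_one_iff.mp h with rfl | rfl <;> simp
        linear_combination (g x * star (g x)) * ha
      · have : (p x : ℕ) ≠ p y := fun h => hxy (p.injective (Fin.ext h))
        rw [if_neg (by omega), if_neg hxy, star_zero, mul_zero]
    · simp only [if_neg hx, ite_self]
      refine Finset.sum_eq_zero fun z _ => ?_
      rw [if_neg (by omega), zero_mul]
  rw [← rank_self_mul_conjTranspose, hdiag, rank_diagonal]
  have hne (x : ι) : (if r ≤ (p x : ℕ) then (g x * star (g x)) else 0) ≠ 0 ↔
      r ≤ (p x : ℕ) := by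
    simp [hg0]
  simp only [hne]
  rw [Fintype.card_congr (p.subtypeEquiv (q := fun i : Fin m => r ≤ (i : ℕ)) fun _ => Iff.rfl),
    Fintype.card_subtype]
  have hcard := Finset.card_filter_add_card_filter_not (s := (Finset.univ : Finset (Fin m)))
    (fun i => (i : ℕ) < r)
  simp only [not_lt, Finset.card_univ, Fintype.card_fin, Fin.card_filter_val_lt] at hcard
  omega

end SignedShift

/-- `s` is the multiset of Jordan block sizes of a matrix `[[A, B], [C, -Aᵀ]]`
with `B`, `C` symmetric. -/
def IsSpJordanType (s : Multiset ℕ) : Prop :=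
  ∃ (ι : Type) (_ : Fintype ι) (_ : DecidableEq ι) (A B C : Matrix ι ι ℂ),
    B.IsSymm ∧ C.IsSymm ∧
      ∀ r : ℕ, (fromBlocks A B C (-Aᵀ) ^ r).rank = (s.map fun p => p - r).sum

namespace IsSpJordanType

theorem zero : IsSpJordanType 0 :=
  ⟨Empty, inferInstance, inferInstance, 0, 0, 0, rfl, rfl, fun r => by
    rw [Subsingleton.elim (_ ^ r) 0, rank_zero]; rfl⟩

theorem add {s t : Multiset ℕ} (hs : IsSpJordanType s) (ht : IsSpJordanType t) :
    IsSpJordanType (s + t) := by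
  obtain ⟨ι, _, _, A, B, C, hB, hC, h⟩ := hs
  obtain ⟨κ, _, _, A', B', C', hB', hC', h'⟩ := ht
  refine ⟨ι ⊕ κ, inferInstance, inferInstance, fromBlocks A 0 0 A', fromBlocks B 0 0 B',
    fromBlocks C 0 0 C', hB.fromBlocks transpose_zero hB', hC.fromBlocks transpose_zero hC',
    fun r => ?_⟩
  have hblock : fromBlocks (fromBlocks A 0 0 A') (fromBlocks B 0 0 B') (fromBlocks C 0 0 C')
      (-(fromBlocks A 0 0 A')ᵀ) = reindexAlgEquiv ℂ ℂ (Equiv.sumSumSumComm ι ι κ κ)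
        (fromBlocks (fromBlocks A B C (-Aᵀ)) 0 0 (fromBlocks A' B' C' (-A'ᵀ))) := by
    ext i j
    rcases i with (i | i) | (i | i) <;> rcases j with (j | j) | (j | j) <;>
      simp [Equiv.sumSumSumComm]
  rw [hblock, ← map_pow, coe_reindexAlgEquiv, rank_reindex, fromBlocks_diagonal_pow,
    rank_fromBlocks_diagonal, h, h', Multiset.map_add, Multiset.sum_add]

theorem pair (m : ℕ) : IsSpJordanType {m, m} := by
  have hone : ∀ x : Fin m, (fun _ => 1 : Fin m → ℂ) x * (fun _ => 1 : Fin m → ℂ) x = 1 := by simp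
  refine ⟨Fin m, inferInstance, inferInstance,
    signedShift (Equiv.refl _) (fun _ => 1) 1, 0, 0, transpose_zero, transpose_zero, fun r => ?_⟩
  have hneg : ((-(signedShift (Equiv.refl (Fin m)) (fun _ => 1) 1)ᵀ) ^ r).rank = m - r := by
    rw [_root_.neg_pow, rank_mul_eq_right_of_isUnit_det _ _
      ((isUnit_iff_isUnit_det _).mp ((isUnit_one (M := Matrix (Fin m) (Fin m) ℂ)).neg.pow r)), ← transpose_pow, rank_transpose,
      signedShift_pow hone, rank_signedShift hone]
  rw [fromBlocks_diagonal_pow, rank_fromBlocks_diagonal, hneg, signedShift_pow hone,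
    rank_signedShift hone]
  simp

theorem even (k : ℕ) : IsSpJordanType {2 * k} := by
  let p : Fin k ⊕ Fin k ≃ Fin (2 * k) :=
    (Equiv.sumComm _ _).trans <| (Equiv.sumCongr Fin.revPerm (Equiv.refl _)).trans <|
      finSumFinEquiv.trans (finCongr (two_mul k).symm)
  let g : Fin k ⊕ Fin k → ℂ := Sum.elim (fun _ => 1) fun i => (-1) ^ (i : ℕ)
  have hg (x) : g x * g x = 1 := by
    cases x <;> simp [g, ← mul_pow]
  have hpl (i : Fin k) : (p (Sum.inl i) : ℕ) = k + i := by simp [p, add_comm]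
  have hpr (i : Fin k) : (p (Sum.inr i) : ℕ) = k - (i + 1) := by simp [p]
  let A : Matrix (Fin k) (Fin k) ℂ := of fun i j => if (i : ℕ) = j + 1 then 1 else 0
  let B : Matrix (Fin k) (Fin k) ℂ := of fun i j => if (i : ℕ) = 0 ∧ (j : ℕ) = 0 then 1 else 0
  have hN : fromBlocks A B 0 (-Aᵀ) = signedShift p g 1 := by
    ext x y
    rcases x with i | i <;> rcases y with j | j <;>
      simp only [signedShift, of_apply, fromBlocks_apply₁₁, fromBlocks_apply₁₂,
        fromBlocks_apply₂₁, fromBlocks_apply₂₂, hpl, hpr, A, B, g, Sum.elim_inl, Sum.elim_inr,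
        Matrix.neg_apply, transpose_apply, Matrix.zero_apply]
    · exact if_congr (by omega) (by simp) rfl
    · by_cases h : (i : ℕ) = 0 ∧ (j : ℕ) = 0
      · rw [if_pos h, if_pos (by omega), h.2]; simp
      · rw [if_neg h, if_neg (by omega)]
    · rw [if_neg (by omega)]
    · by_cases h : (j : ℕ) = i + 1
      · rw [if_pos h, if_pos (by omega), h, pow_succ, ← mul_assoc, ← mul_pow]; simp
      · rw [if_neg h, if_neg (by omega), neg_zero]
  refine ⟨Fin k, inferInstance, inferInstance, A, B, 0, ?_, transpose_zero, fun r => ?_⟩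
  · ext i j
    simp [B, and_comm]
  · rw [hN, signedShift_pow hg, rank_signedShift hg]
    simp

theorem of_even_count_of_odd (s : Multiset ℕ) (hs : ∀ p, Odd p → Even (s.count p)) :
    IsSpJordanType s := by
  induction s using Multiset.strongInductionOn with
  | ih s ih =>
    rcases s.empty_or_exists_mem with rfl | ⟨p, hp⟩
    · exact zero
    obtain ⟨t, rfl⟩ := Multiset.exists_cons_of_mem hp
    rcases Nat.even_or_odd p with hpe | hpo
    · have ht : IsSpJordanType t := ih t (Multiset.lt_cons_self t p) fun q hq => by
        have hne : q ≠ p := by rintro rfl; exact Nat.not_even_iff_odd.mpr hq hpe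
        simpa [Multiset.count_cons_of_ne hne] using hs q hq
      obtain ⟨k, rfl⟩ := even_iff_exists_two_mul.mp hpe
      exact (even k).add ht
    · have hpt : p ∈ t := by
        by_contra h
        have := hs p hpo
        rw [Multiset.count_cons_self, Multiset.count_eq_zero_of_notMem h] at this
        exact absurd this (by decide)
      obtain ⟨u, rfl⟩ := Multiset.exists_cons_of_mem hpt
      have hu : IsSpJordanType u := by
        refine ih u ((Multiset.lt_cons_self u p).trans (Multiset.lt_cons_self _ p)) fun q hq => ?_
        have := hs q hq
        by_cases hqp : q = p
        · subst hqp
          simpa [Multiset.count_cons_self, Nat.even_add_one] using this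
        · simpa [Multiset.count_cons_of_ne hqp] using this
      simpa using (pair p).add hu

end IsSpJordanType

/-- Every partition of `2n` in which each odd part occurs with even multiplicity
is the Jordan type of a nilpotent element of `sp(2n, ℂ)`: there is a nilpotent matrix `N` with
`Nᵀ J + J N = 0` and `rank(N^r) = Σᵢ max(λᵢ − r, 0)` for all `r`. -/
theorem partition_is_sp_jordan_type
    (n : ℕ) (P : Nat.Partition (2 * n))
    (hodd : ∀ p : ℕ, Odd p → Even (P.parts.count p)) :
    ∃ N : Matrix (Fin n ⊕ Fin n) (Fin n ⊕ Fin n) ℂ,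
      IsNilpotent N ∧
      N.transpose * Matrix.fromBlocks 0 1 (-1) 0 +
        Matrix.fromBlocks 0 1 (-1) 0 * N = 0 ∧
      ∀ r : ℕ, (N ^ r).rank = (P.parts.map (fun p => p - r)).sum := by
  obtain ⟨ι, _, _, A, B, C, hB, hC, hrank⟩ := IsSpJordanType.of_even_count_of_odd P.parts hodd
  have hcard : Fintype.card ι = n := by
    have h := hrank 0
    simp only [pow_zero, rank_one, Fintype.card_sum, Nat.sub_zero, Multiset.map_id',
      P.parts_sum] at h
    omega
  let e : ι ≃ Fin n := Fintype.equivFinOfCardEq hcard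
  let φ := reindexAlgEquiv ℂ ℂ (Equiv.sumCongr e e)
  have hφ : φ (fromBlocks A B C (-Aᵀ)) =
      fromBlocks (reindex e e A) (reindex e e B) (reindex e e C) (-(reindex e e A)ᵀ) := by
    ext i j
    cases i <;> cases j <;> simp [φ]
  have hpow (r : ℕ) : (φ (fromBlocks A B C (-Aᵀ)) ^ r).rank =
      (P.parts.map fun p => p - r).sum := by
    rw [← map_pow, coe_reindexAlgEquiv, rank_reindex, hrank]
  refine ⟨φ (fromBlocks A B C (-Aᵀ)), ⟨2 * n, ?_⟩, ?_, hpow⟩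
  · refine eq_zero_of_rank_eq_zero ?_
    rw [hpow, Multiset.sum_eq_zero_iff]
    intro x hx
    obtain ⟨p, hp, rfl⟩ := Multiset.mem_map.mp hx
    have := Multiset.le_sum_of_mem hp
    rw [P.parts_sum] at this
    omega
  · have hB' : (reindex e e B)ᵀ = reindex e e B := by rw [transpose_reindex, hB]
    have hC' : (reindex e e C)ᵀ = reindex e e C := by rw [transpose_reindex, hC]
    rw [hφ, fromBlocks_transpose, fromBlocks_multiply, fromBlocks_multiply, fromBlocks_add, hB',
      hC']
    simp
end

section
/- Let N and M be nilpotent 2n×2n complex matrices with Nᵀ·J + J·N = 0 and Mᵀ·J + J·M = 0, where J = [[0, Iₙ],[−Iₙ, 0]]. Then there exists g ∈ Sp(2n,ℂ) with M = g·N·g⁻¹ if and only if rank(N^r) = rank(M^r) for every r ≥ 1. In other words, nilpotent Sp(2n,ℂ)-orbits in sp(2n,ℂ) are classified by their Jordan types. -/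
open Module

theorem finrank_range_restrict_range_pow {K V : Type*} [Field K] [AddCommGroup V] [Module K V]
    (f : End K V) (r : ℕ) :
    finrank K (LinearMap.range ((f.restrict (p := LinearMap.range f) (q := LinearMap.range f)
      fun x _ ↦ f.mem_range_self x) ^ r)) =
      finrank K (LinearMap.range (f ^ (r + 1))) := by
  have h : (LinearMap.range ((f.restrict (p := LinearMap.range f) (q := LinearMap.range f)
      fun x _ ↦ f.mem_range_self x) ^ r)).map (LinearMap.range f).subtype =
      LinearMap.range (f ^ (r + 1)) := by
    rw [Module.End.pow_restrict]
    ext y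
    simp only [Submodule.mem_map, LinearMap.mem_range, Submodule.subtype_apply]
    constructor
    · rintro ⟨_, ⟨⟨_, x, rfl⟩, rfl⟩, rfl⟩
      exact ⟨x, by simp [pow_succ]⟩
    · rintro ⟨x, rfl⟩
      exact ⟨_, ⟨⟨f x, x, rfl⟩, rfl⟩, by simp [pow_succ]⟩
  rw [← h, Submodule.finrank_map_subtype_eq]

theorem finrank_complement_range_inf_ker {K V : Type*} [Field K] [AddCommGroup V] [Module K V]
    [FiniteDimensional K V] (f : End K V) {Q : Submodule K V}
    (hd : Disjoint (LinearMap.range f ⊓ LinearMap.ker f) Q)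
    (hs : LinearMap.range f ⊓ LinearMap.ker f ⊔ Q = LinearMap.ker f) :
    finrank K Q + 2 * finrank K (LinearMap.range f) =
      finrank K V + finrank K (LinearMap.range (f ^ 2)) := by
  have h1 := Submodule.finrank_sup_add_finrank_inf_eq (LinearMap.range f ⊓ LinearMap.ker f) Q
  rw [hs, hd.eq_bot, finrank_bot] at h1
  have h2 := f.finrank_range_add_finrank_ker
  have h3 := (f.domRestrict (LinearMap.range f)).finrank_range_add_finrank_ker
  rw [LinearMap.range_domRestrict, LinearMap.ker_domRestrict, ← Submodule.finrank_map_subtype_eq,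
    Submodule.map_comap_subtype, ← LinearMap.range_comp, ← Module.End.mul_eq_comp, ← pow_two] at h3
  omega

/-- Two endomorphisms of finite-dimensional vector spaces whose powers have the same ranks are
conjugate as soon as one of them is nilpotent. -/
theorem exists_linearEquiv_intertwining_of_finrank_range_pow_eq {K : Type*} [Field K] (m : ℕ)
    {V V' : Type*} [AddCommGroup V] [Module K V] [FiniteDimensional K V]
    [AddCommGroup V'] [Module K V'] [FiniteDimensional K V']
    (f : End K V) (f' : End K V') (hf : f ^ m = 0)
    (hrank : ∀ r, finrank K (LinearMap.range (f ^ r)) = finrank K (LinearMap.range (f' ^ r))) :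
    ∃ e : V ≃ₗ[K] V', ∀ x, f' (e x) = e (f x) := by
  induction m generalizing V V' with
  | zero =>
    have hV : Subsingleton V := by
      refine subsingleton_of_forall_eq 0 fun x ↦ ?_
      simpa using LinearMap.congr_fun hf x
    have h0 : finrank K V = finrank K V' := by
      have h := hrank 0
      rwa [pow_zero, pow_zero, Module.End.one_eq_id, Module.End.one_eq_id, LinearMap.range_id,
        LinearMap.range_id, finrank_top, finrank_top] at h
    refine ⟨LinearEquiv.ofFinrankEq V V' h0, fun x ↦ ?_⟩
    rw [Subsingleton.elim x 0]
    simp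
  | succ m ih =>
    have h0 : finrank K V = finrank K V' := by
      have h := hrank 0
      rwa [pow_zero, pow_zero, Module.End.one_eq_id, Module.End.one_eq_id, LinearMap.range_id,
        LinearMap.range_id, finrank_top, finrank_top] at h
    obtain ⟨φ, hφ⟩ := ih (f.restrict (p := LinearMap.range f) fun x _ ↦ f.mem_range_self x)
      (f'.restrict (p := LinearMap.range f') fun x _ ↦ f'.mem_range_self x)
      (by
        ext ⟨_, y, rfl⟩
        rw [Module.End.pow_restrict]
        simpa [pow_succ] using LinearMap.congr_fun hf y)
      (fun r ↦ by rw [finrank_range_restrict_range_pow, finrank_range_restrict_range_pow, hrank])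
    have hφ' (w : LinearMap.range f) : f' (φ w) = φ (f.rangeRestrict w) :=
      congrArg Subtype.val (hφ w)
    obtain ⟨Q, hQ, hQs⟩ := IsModularLattice.exists_disjoint_and_sup_eq
      (inf_le_right : LinearMap.range f ⊓ LinearMap.ker f ≤ LinearMap.ker f)
    obtain ⟨Q', hQ', hQs'⟩ := IsModularLattice.exists_disjoint_and_sup_eq
      (inf_le_right : LinearMap.range f' ⊓ LinearMap.ker f' ≤ LinearMap.ker f')
    have hQk : Q ≤ LinearMap.ker f := hQs ▸ le_sup_right
    have hQk' : Q' ≤ LinearMap.ker f' := hQs' ▸ le_sup_right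
    have hQd : Disjoint (LinearMap.range f) Q := by
      rw [disjoint_iff, ← inf_eq_right.mpr hQk, ← inf_assoc]; exact hQ.eq_bot
    have hQd' : Disjoint (LinearMap.range f') Q' := by
      rw [disjoint_iff, ← inf_eq_right.mpr hQk', ← inf_assoc]; exact hQ'.eq_bot
    have hQfin : finrank K Q = finrank K Q' := by
      have h1 := finrank_complement_range_inf_ker f hQ hQs
      have h2 := finrank_complement_range_inf_ker f' hQ' hQs'
      have h3 := hrank 1
      have h4 := hrank 2
      rw [pow_one, pow_one] at h3
      omega
    let e₀ : Q ≃ₗ[K] Q' := LinearEquiv.ofFinrankEq Q Q' hQfin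
    obtain ⟨C, hC⟩ := exists_isCompl (LinearMap.range f ⊔ Q)
    have hW : IsCompl (LinearMap.range f) (Q ⊔ C) := hQd.isCompl_sup_right_of_isCompl_sup_left hC
    have hQc : IsCompl Q (LinearMap.range f ⊔ C) :=
      hQd.symm.isCompl_sup_right_of_isCompl_sup_left (by rwa [sup_comm])
    let pW := (LinearMap.range f).projectionOnto _ hW
    let pQ := Q.projectionOnto _ hQc
    obtain ⟨s, hs⟩ := f'.rangeRestrict.exists_rightInverse_of_surjective f'.range_rangeRestrict
    have hs' (y) : f' (s y) = y := congrArg Subtype.val (LinearMap.congr_fun hs y)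
    let L : V →ₗ[K] V' := s ∘ₗ φ.toLinearMap ∘ₗ f.rangeRestrict
    have hL (x) : f' (L x) = φ (f.rangeRestrict x) := hs' _
    let F : V →ₗ[K] V' := (Submodule.subtype _ ∘ₗ φ.toLinearMap ∘ₗ pW)
      + (Q'.subtype ∘ₗ e₀.toLinearMap ∘ₗ pQ)
      + L ∘ₗ (LinearMap.id - Submodule.subtype _ ∘ₗ pW - Q.subtype ∘ₗ pQ)
    have hF_apply (x) : F x = φ (pW x) + e₀ (pQ x) + L (x - pW x - pQ x) := rfl
    have hF (x) : f' (F x) = φ (f.rangeRestrict x) := by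
      have h1 : f' (e₀ (pQ x)) = 0 := hQk' (e₀ (pQ x)).2
      have h2 : f.rangeRestrict (pQ x : V) = 0 := Subtype.ext (hQk (pQ x).2)
      rw [hF_apply, map_add, map_add, hφ', h1, hL, map_sub, h2, sub_zero, map_sub, map_sub]
      simp
    have hinj : Function.Injective F := by
      rw [← LinearMap.ker_eq_bot, LinearMap.ker_eq_bot']
      intro x hx
      have hxk : x ∈ LinearMap.ker f := by
        have h := hF x
        rw [hx, map_zero] at h
        have h' : f.rangeRestrict x = 0 := by
          apply φ.injective
          rw [map_zero]
          exact Subtype.ext h.symm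
        exact congrArg Subtype.val h'
      rw [← hQs] at hxk
      obtain ⟨w, hw, q, hq, rfl⟩ := Submodule.mem_sup.mp hxk
      have e1 : pW (w + q) = ⟨w, hw.1⟩ := by
        rw [map_add]
        have a1 : pW w = ⟨w, hw.1⟩ := Submodule.projectionOnto_apply_left hW ⟨w, hw.1⟩
        have a2 : pW q = 0 := (Submodule.projectionOnto_apply_eq_zero_iff hW).mpr
          (Submodule.mem_sup_left hq)
        rw [a1, a2, add_zero]
      have e2 : pQ (w + q) = ⟨q, hq⟩ := by
        rw [map_add]
        have a1 : pQ q = ⟨q, hq⟩ := Submodule.projectionOnto_apply_left hQc ⟨q, hq⟩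
        have a2 : pQ w = 0 := (Submodule.projectionOnto_apply_eq_zero_iff hQc).mpr
          (Submodule.mem_sup_left hw.1)
        rw [a1, a2, zero_add]
      rw [hF_apply, e1, e2, add_sub_cancel_left, sub_self, map_zero, add_zero] at hx
      have h5 : (φ ⟨w, hw.1⟩ : V') = 0 := by
        refine Submodule.disjoint_def.mp hQd' _ (φ _).2 ?_
        rw [eq_neg_of_add_eq_zero_left hx]
        exact Q'.neg_mem (e₀ _).2
      rw [h5, zero_add] at hx
      have hw0 : (⟨w, hw.1⟩ : LinearMap.range f) = 0 :=
        φ.injective (by rw [map_zero]; exact Subtype.ext h5)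
      have hq0 : (⟨q, hq⟩ : Q) = 0 :=
        e₀.injective (by rw [map_zero]; exact Subtype.ext hx)
      rw [show w = 0 from congrArg Subtype.val hw0, show q = 0 from congrArg Subtype.val hq0,
        add_zero]
    have hF' (x) : f' (F x) = F (f x) := by
      have a1 : pW (f x) = f.rangeRestrict x :=
        Submodule.projectionOnto_apply_left hW (f.rangeRestrict x)
      have a2 : pQ (f x) = 0 := (Submodule.projectionOnto_apply_eq_zero_iff hQc).mpr
          (Submodule.mem_sup_left ⟨x, rfl⟩)
      rw [hF, hF_apply, a1, a2]
      simp
    exact ⟨LinearEquiv.ofInjectiveOfFinrankEq F hinj h0, hF'⟩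

open Polynomial in
theorem mul_aeval_eq_aeval_mul {R A : Type*} [CommSemiring R] [Semiring A] [Algebra R A]
    {x a b : A} (h : x * a = b * x) (p : R[X]) : x * aeval a p = aeval b p * x := by
  induction p using Polynomial.induction_on' with
  | add p q hp hq => rw [map_add, map_add, mul_add, add_mul, hp, hq]
  | monomial n r =>
    have hn : x * a ^ n = b ^ n * x := SemiconjBy.pow_right h n
    rw [aeval_monomial, aeval_monomial, mul_assoc, ← hn, ← mul_assoc, ← Algebra.commutes, mul_assoc]

open Polynomial in
theorem Matrix.transpose_aeval {R ι : Type*} [CommSemiring R] [Fintype ι] [DecidableEq ι]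
    (A : Matrix ι ι R) (p : R[X]) : (aeval A p).transpose = aeval A.transpose p := by
  induction p using Polynomial.induction_on' with
  | add p q hp hq => rw [map_add, map_add, transpose_add, hp, hq]
  | monomial n r => simp [aeval_monomial, ← Algebra.smul_def, transpose_pow]

open Polynomial in
/-- Over an algebraically closed field of characteristic not two, `X` has a square root modulo
every polynomial with non-zero constant coefficient. -/
theorem Polynomial.exists_dvd_sq_sub_X {K : Type*} [Field K] [IsAlgClosed K] [NeZero (2 : K)]
    {P : K[X]} (hP : P.Monic) (h0 : P.coeff 0 ≠ 0) : ∃ p : K[X], P ∣ p ^ 2 - X := by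
  classical
  choose s hs using fun z : K ↦ IsAlgClosed.exists_pow_nat_eq z two_pos
  let q := Lagrange.interpolate P.roots.toFinset id s
  have hq (z) (hz : z ∈ P.roots) : (q.eval z) ^ 2 = z := by
    have h : q.eval z = s z :=
      Lagrange.eval_interpolate_at_node s (v := id) (Set.injOn_id _) (Multiset.mem_toFinset.mpr hz)
    rw [h, hs]
  have hdvd : P ∣ (q ^ 2 - X) ^ P.roots.card := by
    have h := (IsAlgClosed.splits P).eq_prod_roots
    rw [hP.leadingCoeff, map_one, one_mul] at h
    have := Multiset.prod_dvd_prod_of_dvd (S := P.roots) (fun z ↦ X - C z)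
      (fun _ ↦ q ^ 2 - X) (fun z hz ↦ by simp [dvd_iff_isRoot, hq z hz])
    rw [← h] at this
    simpa using this
  have hnil : IsNilpotent (AdjoinRoot.mk P q ^ 2 - AdjoinRoot.root P) := by
    refine ⟨P.roots.card, ?_⟩
    rw [← AdjoinRoot.mk_X, ← map_pow, ← map_sub, ← map_pow]
    exact AdjoinRoot.mk_eq_zero.mpr hdvd
  have hX : IsUnit (AdjoinRoot.root P) := by
    have hco : IsCoprime X P :=
      (irreducible_X.coprime_iff_not_dvd).mpr fun h ↦ h0 (X_dvd_iff.mp h)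
    obtain ⟨u, v, huv⟩ := hco
    refine IsUnit.of_mul_eq_one_right (AdjoinRoot.mk P u) ?_
    have := congrArg (AdjoinRoot.mk P) huv
    simpa using this
  have hq_unit : IsUnit (AdjoinRoot.mk P q) := by
    have := hnil.isUnit_add_left_of_commute hX (Commute.all _ _)
    rw [add_sub_cancel] at this
    exact (isUnit_pow_iff two_ne_zero).mp this
  have h2 : IsUnit (2 : AdjoinRoot P) := by
    have h := (IsUnit.mk0 (2 : K) two_ne_zero).map (algebraMap K (AdjoinRoot P))
    rwa [map_ofNat] at h
  let T : (AdjoinRoot P)[X] := X ^ 2 - C (AdjoinRoot.root P)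
  obtain ⟨r, ⟨-, hr⟩, -⟩ := existsUnique_nilpotent_sub_and_aeval_eq_zero (P := T)
    (x := AdjoinRoot.mk P q) (by simpa [T] using hnil)
    (by simpa [T, one_add_one_eq_two] using h2.mul hq_unit)
  obtain ⟨p, rfl⟩ := AdjoinRoot.mk_surjective r
  refine ⟨p, AdjoinRoot.mk_eq_zero.mp ?_⟩
  simpa [T] using hr

open Polynomial in
theorem Matrix.exists_aeval_sq_eq {K ι : Type*} [Field K] [IsAlgClosed K] [NeZero (2 : K)]
    [Fintype ι] [DecidableEq ι] {A : Matrix ι ι K} (hA : IsUnit A.det) :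
    ∃ p : K[X], aeval A p ^ 2 = A := by
  obtain ⟨p, c, hp⟩ := Polynomial.exists_dvd_sq_sub_X A.charpoly_monic
    (by
      intro h
      rw [A.det_eq_sign_charpoly_coeff, h, mul_zero] at hA
      exact not_isUnit_zero hA)
  refine ⟨p, ?_⟩
  have := congrArg (aeval A) hp
  rwa [map_mul, A.aeval_self_charpoly, zero_mul, map_sub, map_pow, aeval_X, sub_eq_zero] at this

open Polynomial in
/-- Two matrices which are skew-adjoint for the same invertible antisymmetric matrix `J` are
conjugate by an isometry of `J` as soon as they are conjugate. -/
theorem Matrix.exists_isometry_conj_of_conj {K ι : Type*} [Field K] [IsAlgClosed K]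
    [NeZero (2 : K)] [Fintype ι] [DecidableEq ι] {J N M g : Matrix ι ι K}
    (hJ : IsUnit J.det) (hJt : J.transpose = -J) (hg : IsUnit g.det)
    (hN : N.transpose * J + J * N = 0) (hM : M.transpose * J + J * M = 0) (hgN : g * N = M * g) :
    ∃ h : Matrix ι ι K, h.transpose * J * h = J ∧ M = h * N * h⁻¹ := by
  let J' := g.transpose * J * g
  let A := J⁻¹ * J'
  have hJA : J * A = J' := mul_nonsing_inv_cancel_left _ _ hJ
  have hA : IsUnit A.det := by
    simp only [A, J', det_mul, det_transpose]
    exact (J.isUnit_nonsing_inv_det hJ).mul ((hg.mul hJ).mul hg)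
  have hAJ : A.transpose * J = J * A := by
    have h : A.transpose * J.transpose = J'.transpose := by
      rw [← transpose_mul, hJA]
    have h' : J'.transpose = -J' := by
      simp [J', transpose_mul, hJt, Matrix.mul_assoc]
    rw [hJt, h', Matrix.mul_neg, neg_inj] at h
    rw [h, hJA]
  have hcomm : A * N = N * A := by
    have h1 : J' * N = - (N.transpose * J') := by
      calc J' * N = g.transpose * (J * M) * g := by
            simp only [J', Matrix.mul_assoc, hgN]
        _ = - ((M * g).transpose * J * g) := by
            rw [eq_neg_of_add_eq_zero_right hM, transpose_mul]
            simp only [Matrix.mul_assoc, Matrix.mul_neg, Matrix.neg_mul]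
        _ = - (N.transpose * J') := by
            rw [← hgN, transpose_mul]
            simp only [J', Matrix.mul_assoc]
    have h2 : J * (A * N) = J * (N * A) := by
      rw [← Matrix.mul_assoc, hJA, h1, ← Matrix.mul_assoc J N, eq_neg_of_add_eq_zero_right hN,
        ← hJA, Matrix.neg_mul, Matrix.mul_assoc]
    have := congrArg (J⁻¹ * ·) h2
    simpa only [nonsing_inv_mul_cancel_left _ _ hJ] using this
  obtain ⟨p, hp⟩ := Matrix.exists_aeval_sq_eq hA
  let S := aeval A p
  have hS : IsUnit S.det := by
    have := congrArg det hp
    rw [det_pow] at this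
    rw [← this] at hA
    exact (isUnit_pow_iff two_ne_zero).mp hA
  have hSN : S * N = N * S := by
    exact (mul_aeval_eq_aeval_mul hcomm.symm p).symm
  have hSJ : S.transpose * J = J * S := by
    rw [transpose_aeval]
    exact (mul_aeval_eq_aeval_mul hAJ.symm p).symm
  have hSJS : S.transpose * J * S = J' := by
    rw [hSJ, Matrix.mul_assoc, ← pow_two, hp, hJA]
  have hgdet : IsUnit (g * S⁻¹).det := by
    rw [det_mul]; exact hg.mul (S.isUnit_nonsing_inv_det hS)
  refine ⟨g * S⁻¹, ?_, ?_⟩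
  · calc (g * S⁻¹).transpose * J * (g * S⁻¹) = S⁻¹.transpose * J' * S⁻¹ := by
          simp only [J', transpose_mul, Matrix.mul_assoc]
      _ = (S * S⁻¹).transpose * J * (S * S⁻¹) := by
          rw [← hSJS]
          simp only [transpose_mul, Matrix.mul_assoc]
      _ = J := by simp [S.mul_nonsing_inv hS]
  · have h : M * (g * S⁻¹) = g * S⁻¹ * N := by
      have h' : S⁻¹ * N = N * S⁻¹ := by
        calc S⁻¹ * N = S⁻¹ * (N * S) * S⁻¹ := by
              rw [Matrix.mul_assoc, Matrix.mul_assoc, S.mul_nonsing_inv hS, Matrix.mul_one]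
          _ = N * S⁻¹ := by
              rw [← hSN, nonsing_inv_mul_cancel_left _ _ hS]
      rw [← Matrix.mul_assoc, ← hgN, Matrix.mul_assoc, Matrix.mul_assoc, h']
    rw [← h, Matrix.mul_assoc, Matrix.mul_nonsing_inv _ hgdet, Matrix.mul_one]

/-- Two square matrices whose powers have the same ranks are conjugate as soon as one of them is
nilpotent. -/
theorem Matrix.exists_conj_of_rank_pow_eq {K ι : Type*} [Field K] [Fintype ι] [DecidableEq ι]
    {N M : Matrix ι ι K} (hN : IsNilpotent N) (h : ∀ r, (N ^ r).rank = (M ^ r).rank) :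
    ∃ g : Matrix ι ι K, IsUnit g.det ∧ g * N = M * g := by
  obtain ⟨m, hm⟩ := hN
  obtain ⟨e, he⟩ := exists_linearEquiv_intertwining_of_finrank_range_pow_eq m
    (toLin' N) (toLin' M) (by rw [← toLin'_pow, hm, map_zero])
    (fun r ↦ by rw [← toLin'_pow, ← toLin'_pow]; exact h r)
  refine ⟨LinearMap.toMatrix' e.toLinearMap, ?_, ?_⟩
  · rw [LinearMap.det_toMatrix']
    exact e.isUnit_det'
  · apply toLin'.injective
    rw [toLin'_mul, toLin'_mul, toLin'_toMatrix']
    exact LinearMap.ext fun x ↦ (he x).symm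

/-- Two nilpotent elements `N, M` of `sp(2n, ℂ)` are conjugate by an element of
`Sp(2n, ℂ)` if and only if `rank(N^r) = rank(M^r)` for all `r ≥ 1`. -/
theorem sp_nilpotent_orbits_classified_by_jordan_type
    (n : ℕ) (N M : Matrix (Fin n ⊕ Fin n) (Fin n ⊕ Fin n) ℂ)
    (hNnil : IsNilpotent N) (hMnil : IsNilpotent M)
    (hNsp : N.transpose * Matrix.fromBlocks 0 1 (-1) 0 +
        Matrix.fromBlocks 0 1 (-1) 0 * N = 0)
    (hMsp : M.transpose * Matrix.fromBlocks 0 1 (-1) 0 +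
        Matrix.fromBlocks 0 1 (-1) 0 * M = 0) :
    (∃ g : Matrix (Fin n ⊕ Fin n) (Fin n ⊕ Fin n) ℂ,
        g.transpose * Matrix.fromBlocks 0 1 (-1) 0 * g = Matrix.fromBlocks 0 1 (-1) 0 ∧
        M = g * N * g⁻¹) ↔
      (∀ r : ℕ, 1 ≤ r → (N ^ r).rank = (M ^ r).rank) := by
  have hJ : Matrix.fromBlocks 0 1 (-1) 0 = -Matrix.J (Fin n) ℂ := by
    simp [Matrix.J, Matrix.fromBlocks_neg]
  rw [hJ] at hNsp hMsp ⊢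
  have hJdet : IsUnit (-Matrix.J (Fin n) ℂ).det := by
    rw [Matrix.det_neg]
    exact ((isUnit_one.neg).pow _).mul (Matrix.isUnit_det_J _ _)
  constructor
  · rintro ⟨g, hg, rfl⟩ r -
    have hgdet : IsUnit g.det := by
      rw [← hg, Matrix.det_mul, Matrix.det_mul, Matrix.det_transpose] at hJdet
      exact isUnit_of_mul_isUnit_right hJdet
    have hpow : (g * N * g⁻¹) ^ r = g * N ^ r * g⁻¹ := by
      have hs : SemiconjBy g N (g * N * g⁻¹) :=
        (Matrix.nonsing_inv_mul_cancel_right _ _ hgdet).symm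
      rw [(hs.pow_right r).eq, Matrix.mul_nonsing_inv_cancel_right _ _ hgdet]
    rw [hpow, Matrix.rank_mul_eq_left_of_isUnit_det _ _ (g.isUnit_nonsing_inv_det hgdet),
      Matrix.rank_mul_eq_right_of_isUnit_det _ _ hgdet]
  · intro h
    obtain ⟨g, hg, hgN⟩ := Matrix.exists_conj_of_rank_pow_eq (M := M) hNnil fun r ↦ by
      rcases r.eq_zero_or_pos with rfl | hr
      · simp
      · exact h r hr
    exact Matrix.exists_isometry_conj_of_conj hJdet (by simp) hg hNsp hMsp hgN
end

section
/- Let λ = (λ₁ ≥ λ₂ ≥ …) be a partition of 2m, and let k be any natural number with 2k+1 ≥ λ₁. For 0 ≤ t ≤ 2k set c_t = #{i : λ_i ≥ 2k+1−t} (the column lengths of the Young diagram of λ, listed in non-increasing order c_{2k} ≥ c_{2k−1} ≥ … ≥ c_0 with zeros appended). Then every odd part of λ occurs with even multiplicity if and only if c_0 is even and c_{2i} + c_{2i−1} is even for every 1 ≤ i ≤ k. -/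
theorem Multiset.card_filter_le_eq_count_add (s : Multiset ℕ) (a : ℕ) :
    (s.filter (fun p => a ≤ p)).card = s.count a + (s.filter (fun p => a + 1 ≤ p)).card := by
  induction s using Multiset.induction_on with
  | empty => simp
  | cons b s ih =>
    simp only [← Multiset.countP_eq_card_filter, Multiset.countP_cons, Multiset.count_cons] at ih ⊢
    split_ifs <;> omega


/-- For a partition `P` of `2m` with largest part at most `2k+1`, and column
lengths `c t = #{i : λᵢ ≥ 2k+1−t}` for `0 ≤ t ≤ 2k`, every odd part of `P` occurs with even
multiplicity iff `c 0` is even and `c (2i) + c (2i−1)` is even for all `1 ≤ i ≤ k`. -/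
theorem sp_column_parity_criterion
    (m k : ℕ) (P : Nat.Partition (2 * m))
    (hk : ∀ p ∈ P.parts, p ≤ 2 * k + 1)
    (c : ℕ → ℕ)
    (hc : ∀ t : ℕ, t ≤ 2 * k →
      c t = (P.parts.filter (fun p => 2 * k + 1 - t ≤ p)).card) :
    (∀ p : ℕ, Odd p → Even (P.parts.count p)) ↔
      (Even (c 0) ∧ ∀ i : ℕ, 1 ≤ i → i ≤ k → Even (c (2 * i) + c (2 * i - 1))) := by
  have h_zero : c 0 = P.parts.count (2 * k + 1) := by
    have h_none : P.parts.filter (fun p => 2 * k + 1 + 1 ≤ p) = 0 :=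
      Multiset.filter_eq_nil.2 fun p hp => by have := hk p hp; omega
    rw [hc 0 (Nat.zero_le _), Nat.sub_zero, Multiset.card_filter_le_eq_count_add, h_none,
      Multiset.card_zero, add_zero]
  have h_pair : ∀ i, 1 ≤ i → i ≤ k →
      c (2 * i) = P.parts.count (2 * k + 1 - 2 * i) + c (2 * i - 1) := by
    intro i hi hik
    have h_index : 2 * k + 1 - (2 * i - 1) = 2 * k + 1 - 2 * i + 1 := by omega
    rw [hc _ (by omega), hc _ (by omega), h_index, Multiset.card_filter_le_eq_count_add]
  constructor
  · intro h
    refine ⟨h_zero ▸ h _ (odd_two_mul_add_one k), fun i hi hik => ?_⟩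
    have h_even := h (2 * k + 1 - 2 * i) ⟨k - i, by omega⟩
    rw [h_pair i hi hik, add_assoc]
    exact h_even.add (Even.add_self _)
  · rintro ⟨h_first, h_sums⟩ p ⟨j, rfl⟩
    rcases lt_trichotomy j k with hj | rfl | hj
    · have h_even := h_sums (k - j) (by omega) (by omega)
      have h_index : 2 * k + 1 - 2 * (k - j) = 2 * j + 1 := by omega
      rw [h_pair (k - j) (by omega) (by omega), h_index, add_assoc, Nat.even_add] at h_even
      exact h_even.2 (Even.add_self _)
    · exact h_zero ▸ h_first
    · have h_notMem : 2 * j + 1 ∉ P.parts := fun hp => by have := hk _ hp; omega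
      simp [Multiset.count_eq_zero_of_notMem h_notMem]
end

section
/- Let λ = (λ₁ ≥ λ₂ ≥ …) be a partition of n, and let k be any natural number with 2k+2 ≥ λ₁. For 0 ≤ t ≤ 2k+1 set b_t = #{i : λ_i ≥ 2k+2−t} (the column lengths of the Young diagram of λ, listed in non-increasing order b_{2k+1} ≥ b_{2k} ≥ … ≥ b_0 with zeros appended). Then every even part of λ occurs with even multiplicity if and only if b_0 is even and b_{2i} + b_{2i−1} is even for every 1 ≤ i ≤ k. -/
theorem Multiset.card_filter_le_eq_add_count (s : Multiset ℕ) (m : ℕ) :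
    (s.filter (fun p => m ≤ p)).card = (s.filter (fun p => m + 1 ≤ p)).card + s.count m := by
  induction s using Multiset.induction_on with
  | empty => simp
  | cons a s ih =>
    simp only [← Multiset.countP_eq_card_filter, Multiset.countP_cons, Multiset.count_cons] at ih ⊢
    grind


/-- For a partition `P` of `n` with largest part at most `2k+2`, and column
lengths `b t = #{i : λᵢ ≥ 2k+2−t}` for `0 ≤ t ≤ 2k+1`, every even part of `P` occurs with even
multiplicity iff `b 0` is even and `b (2i) + b (2i−1)` is even for all `1 ≤ i ≤ k`. -/
theorem o_column_parity_criterion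
    (n k : ℕ) (P : Nat.Partition n)
    (hk : ∀ p ∈ P.parts, p ≤ 2 * k + 2)
    (b : ℕ → ℕ)
    (hb : ∀ t : ℕ, t ≤ 2 * k + 1 →
      b t = (P.parts.filter (fun p => 2 * k + 2 - t ≤ p)).card) :
    (∀ p : ℕ, Even p → Even (P.parts.count p)) ↔
      (Even (b 0) ∧ ∀ i : ℕ, 1 ≤ i → i ≤ k → Even (b (2 * i) + b (2 * i - 1))) := by
  have h_zero : b 0 = P.parts.count (2 * k + 2) := by
    have h_top : P.parts.filter (fun p => 2 * k + 2 + 1 ≤ p) = 0 :=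
      Multiset.filter_eq_nil.2 fun p hp => by have := hk p hp; omega
    rw [hb 0 (by omega), Nat.sub_zero, Multiset.card_filter_le_eq_add_count, h_top,
      Multiset.card_zero, zero_add]
  have h_succ : ∀ i, 1 ≤ i → i ≤ k →
      b (2 * i) = b (2 * i - 1) + P.parts.count (2 * k + 2 - 2 * i) := by
    intro i hi hik
    rw [hb (2 * i) (by omega), hb (2 * i - 1) (by omega),
      Multiset.card_filter_le_eq_add_count,
      show 2 * k + 2 - (2 * i - 1) = 2 * k + 2 - 2 * i + 1 by omega]
  have h_parity : ∀ i, 1 ≤ i → i ≤ k →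
      (Even (b (2 * i) + b (2 * i - 1)) ↔ Even (P.parts.count (2 * k + 2 - 2 * i))) := by
    intro i hi hik
    rw [h_succ i hi hik]
    grind
  constructor
  · intro h
    refine ⟨h_zero ▸ h _ ⟨k + 1, by omega⟩, fun i hi hik => ?_⟩
    exact (h_parity i hi hik).2 (h _ ⟨k + 1 - i, by omega⟩)
  · rintro ⟨h0, h⟩ p ⟨j, rfl⟩
    by_cases hp : j + j ∈ P.parts
    · have h_pos := P.parts_pos hp
      have h_le := hk _ hp
      by_cases hj : j = k + 1
      · rwa [h_zero, show 2 * k + 2 = j + j by omega] at h0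
      · have h_even := (h_parity (k + 1 - j) (by omega) (by omega)).1 (h _ (by omega) (by omega))
        rwa [show 2 * k + 2 - 2 * (k + 1 - j) = j + j by omega] at h_even
    · simp [Multiset.count_eq_zero_of_notMem hp]
end

section
/- Let c = (c_{2k}, c_{2k−1}, …, c_0) be an Sp-column sequence and let c♯ = (a_k, a_k, …, a_1, a_1, c_0) with a_i = (c_{2i}+c_{2i−1})/2. Then for every 1 ≤ r ≤ 2k+1 the sum of the first r entries of c♯ (read from the largest) is at most the sum of the first r entries of c, with equality when r = 2k+1. (This is the combinatorial content of the containment of orbit closures: the closure of the orbit with columns c is contained in the closure of the orbit with columns c♯.) -/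
/-- An Sp-column sequence `(c_{2k}, …, c_0)`, recorded from the bottom: `c j` is the entry
`c_j`, so `c 0 ≤ c 1 ≤ … ≤ c (2k)`, `c 0` is even, and `c (2i) + c (2i−1)` is even for
`1 ≤ i ≤ k`. -/
def IsSpColumnSeq (k : ℕ) (c : ℕ → ℕ) : Prop :=
  (∀ i : ℕ, i < 2 * k → c i ≤ c (i + 1)) ∧ Even (c 0) ∧
    ∀ i : ℕ, 1 ≤ i → i ≤ k → Even (c (2 * i) + c (2 * i - 1))

/-- The sequence `c♯ = (a_k, a_k, …, a_1, a_1, c_0)` with `a_i = (c_{2i}+c_{2i−1})/2`,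
recorded from the bottom: `spSharp c 0 = c 0`, `spSharp c (2i−1) = spSharp c (2i) = a_i`. -/
def spSharp (c : ℕ → ℕ) : ℕ → ℕ :=
  fun j => if j = 0 then c 0
    else (c (2 * ((j + 1) / 2)) + c (2 * ((j + 1) / 2) - 1)) / 2

theorem spSharp_two_mul (c : ℕ → ℕ) {i : ℕ} (hi : 1 ≤ i) :
    spSharp c (2 * i) = (c (2 * i) + c (2 * i - 1)) / 2 := by
  simp only [spSharp]
  rw [if_neg (by omega), show (2 * i + 1) / 2 = i by omega]

theorem spSharp_two_mul_sub_one (c : ℕ → ℕ) {i : ℕ} (hi : 1 ≤ i) :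
    spSharp c (2 * i - 1) = (c (2 * i) + c (2 * i - 1)) / 2 := by
  simp only [spSharp]
  rw [if_neg (by omega), show (2 * i - 1 + 1) / 2 = i by omega]

theorem IsSpColumnSeq.spSharp_pair_sum {k : ℕ} {c : ℕ → ℕ} (hc : IsSpColumnSeq k c) {i : ℕ}
    (hi : 1 ≤ i) (hik : i ≤ k) :
    spSharp c (2 * i) + spSharp c (2 * i - 1) = c (2 * i) + c (2 * i - 1) := by
  obtain ⟨a, ha⟩ := hc.2.2 i hi hik
  rw [spSharp_two_mul c hi, spSharp_two_mul_sub_one c hi]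
  omega

theorem IsSpColumnSeq.spSharp_two_mul_le {k : ℕ} {c : ℕ → ℕ} (hc : IsSpColumnSeq k c) {i : ℕ}
    (hik : i ≤ k) : spSharp c (2 * i) ≤ c (2 * i) := by
  rcases Nat.eq_zero_or_pos i with rfl | hi
  · simp [spSharp]
  · have h := hc.1 (2 * i - 1) (by omega)
    rw [show 2 * i - 1 + 1 = 2 * i by omega] at h
    rw [spSharp_two_mul c hi]
    omega

theorem IsSpColumnSeq.sum_range_two_mul_spSharp {k : ℕ} {c : ℕ → ℕ} (hc : IsSpColumnSeq k c)
    {m : ℕ} (hm : m ≤ k) :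
    ∑ j ∈ Finset.range (2 * m), spSharp c (2 * k - j) =
      ∑ j ∈ Finset.range (2 * m), c (2 * k - j) := by
  induction m with
  | zero => simp
  | succ m ih =>
    have h := hc.spSharp_pair_sum (i := k - m) (by omega) (by omega)
    have h_even : 2 * k - 2 * m = 2 * (k - m) := by omega
    have h_odd : 2 * k - (2 * m + 1) = 2 * (k - m) - 1 := by omega
    simp only [Nat.mul_succ, Finset.sum_range_succ, h_even, h_odd]
    rw [ih (by omega)]
    omega

/-- for `1 ≤ r ≤ 2k+1`, the sum of the largest `r` entries of `c♯` is at most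
the sum of the largest `r` entries of `c`, with equality for `r = 2k+1`. -/
theorem spSharp_dominated (k : ℕ) (c : ℕ → ℕ) (hc : IsSpColumnSeq k c) :
    (∀ r : ℕ, 1 ≤ r → r ≤ 2 * k + 1 →
      ∑ j ∈ Finset.range r, spSharp c (2 * k - j) ≤ ∑ j ∈ Finset.range r, c (2 * k - j)) ∧
    ∑ j ∈ Finset.range (2 * k + 1), spSharp c (2 * k - j) =
      ∑ j ∈ Finset.range (2 * k + 1), c (2 * k - j) := by
  refine ⟨fun r _ hr => ?_, ?_⟩
  · rcases Nat.even_or_odd' r with ⟨m, rfl | rfl⟩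
    · exact (hc.sum_range_two_mul_spSharp (by omega)).le
    · have h := hc.spSharp_two_mul_le (i := k - m) (by omega)
      rw [Finset.sum_range_succ, Finset.sum_range_succ, hc.sum_range_two_mul_spSharp (by omega),
        show 2 * k - 2 * m = 2 * (k - m) by omega]
      omega
  · rw [Finset.sum_range_succ, Finset.sum_range_succ, hc.sum_range_two_mul_spSharp le_rfl]
    simp [spSharp]
end

section
/- Let c = (c_{2k}, …, c_0) be an Sp-column sequence with total sum 2m, and let w(c) = (w_0 ≤ w_1 ≤ … ≤ w_k) be the tuple produced by the pair-removal algorithm. Then w(c) has exactly k+1 entries and w_0 + w_1 + … + w_k = m. -/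
/-- Pair removal on a tuple listed from the bottom (`[c_0, c_1, …]`): repeatedly delete the
adjacent equal pair with smallest index, recording the common value.  The first component is
the remaining tuple `(d_0, d_1, …)`, the second the recorded values `Y`. -/
def pairRemove : List ℕ → List ℕ × List ℕ
  | [] => ([], [])
  | [a] => ([a], [])
  | a :: b :: rest =>
      if a = b then
        ((pairRemove rest).1, a :: (pairRemove rest).2)
      else
        (a :: (pairRemove (b :: rest)).1, (pairRemove (b :: rest)).2)

/-- Helper for `zList`: turns `[d_1, d_2, d_3, d_4, …]` into `[(d_1+d_2)/2, (d_3+d_4)/2, …]`. -/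
def zPairs : List ℕ → List ℕ
  | [] => []
  | [a] => [a / 2]
  | a :: b :: rest => (a + b) / 2 :: zPairs rest

/-- The list `Z = [z_0, z_1, …]` with `z_j = (d_{2j} + d_{2j−1})/2` (and `d_{−1} := 0`),
computed from the remaining tuple `[d_0, d_1, …, d_{2l}]` listed from the bottom. -/
def zList : List ℕ → List ℕ
  | [] => []
  | a :: rest => a / 2 :: zPairs rest

/-- `w(c)`: the multiset `Y ∪ Z` produced by the pair-removal algorithm, sorted
nondecreasingly. -/
def wTuple (c : List ℕ) : List ℕ :=
  ((pairRemove c).2 ++ zList (pairRemove c).1).mergeSort (· ≤ ·)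

/-- The list has even length and splits into consecutive pairs, each with even sum. -/
def PairsEven : List ℕ → Prop
  | [] => True
  | [_] => False
  | a :: b :: rest => Even (a + b) ∧ PairsEven rest

theorem PairsEven.cons_congr {a x : ℕ} {l : List ℕ} (h : Even (a + x))
    (hl : PairsEven (x :: l)) : PairsEven (a :: l) := by
  cases l with
  | nil => exact hl
  | cons b r =>
    simp only [PairsEven] at hl ⊢
    exact ⟨by grind, hl.2⟩

theorem PairsEven.append_pair {a b : ℕ} (h : Even (a + b)) :
    ∀ {l : List ℕ}, PairsEven l → PairsEven (l ++ [a, b])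
  | [], _ => ⟨h, trivial⟩
  | [_], hl => hl.elim
  | _ :: _ :: _, hl => ⟨hl.1, append_pair h hl.2⟩

theorem pairsEven_pairRemove (l : List ℕ) :
    (PairsEven l → PairsEven (pairRemove l).1) ∧
      ∀ a, PairsEven (a :: l) → PairsEven (a :: (pairRemove l).1) := by
  induction l using pairRemove.induct with
  | case1 => simp [pairRemove]
  | case2 x => simp [pairRemove]
  | case3 x r ih =>
    simp only [pairRemove, if_true]
    exact ⟨fun h => ih.1 h.2, fun a h => (ih.2 x h.2).cons_congr h.1⟩
  | case4 x y r hxy ih =>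
    simp only [pairRemove, if_neg hxy]
    exact ⟨ih.2 x, fun a h => ⟨h.1, ih.1 h.2⟩⟩

theorem pairRemove_length_and_sum (l : List ℕ) :
    (pairRemove l).1.length + 2 * (pairRemove l).2.length = l.length ∧
      (pairRemove l).1.sum + 2 * (pairRemove l).2.sum = l.sum := by
  induction l using pairRemove.induct with
  | case1 => simp [pairRemove]
  | case2 x => simp [pairRemove]
  | case3 x r ih =>
    simp only [pairRemove, if_true, List.length_cons, List.sum_cons]
    omega
  | case4 x y r hxy ih =>
    simp only [pairRemove, if_neg hxy, List.length_cons, List.sum_cons] at ih ⊢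
    omega

theorem PairsEven.zPairs_length_and_sum :
    ∀ {l : List ℕ}, PairsEven l →
      2 * (zPairs l).length = l.length ∧ 2 * (zPairs l).sum = l.sum
  | [], _ => by simp [zPairs]
  | [_], h => h.elim
  | a :: b :: r, h => by
    have ih := zPairs_length_and_sum h.2
    have hab := Nat.even_iff.mp h.1
    simp only [zPairs, List.length_cons, List.sum_cons]
    omega

theorem PairsEven.zList_length_and_sum {l : List ℕ} (h : PairsEven (0 :: l)) :
    2 * (zList l).length = l.length + 1 ∧ 2 * (zList l).sum = l.sum := by
  cases l with
  | nil => exact h.elim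
  | cons a r =>
    have hr := h.2.zPairs_length_and_sum
    have ha := Nat.even_iff.mp h.1
    simp only [zList, List.length_cons, List.sum_cons]
    omega

theorem pairsEven_zero_cons_map_range (c : ℕ → ℕ) (h0 : Even (c 0)) (k : ℕ)
    (h : ∀ i : ℕ, 1 ≤ i → i ≤ k → Even (c (2 * i) + c (2 * i - 1))) :
    PairsEven (0 :: (List.range (2 * k + 1)).map c) := by
  induction k with
  | zero => simpa [PairsEven] using h0
  | succ k ih =>
    have hk := h (k + 1) (by omega) le_rfl
    rw [add_comm] at hk
    have := (ih fun i h1 h2 => h i h1 (by omega)).append_pair hk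
    simpa [show 2 * (k + 1) + 1 = 2 * k + 1 + 1 + 1 by ring, List.range_succ, mul_add] using this

/-- for an Sp-column sequence `c` of total sum `2m`, the tuple `w(c)` produced
by the pair-removal algorithm has exactly `k+1` entries and its entries sum to `m`. -/
theorem wTuple_length_and_sum (k m : ℕ) (c : ℕ → ℕ) (hc : IsSpColumnSeq k c)
    (hm : ∑ j ∈ Finset.range (2 * k + 1), c j = 2 * m) :
    (wTuple ((List.range (2 * k + 1)).map c)).length = k + 1 ∧
    (wTuple ((List.range (2 * k + 1)).map c)).sum = m := by
  set l := (List.range (2 * k + 1)).map c with hl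
  have hlen : l.length = 2 * k + 1 := by simp [hl]
  have hsum : l.sum = 2 * m := hm
  have hP := (pairsEven_pairRemove l).2 0 (pairsEven_zero_cons_map_range c hc.2.1 k hc.2.2)
  have hz := hP.zList_length_and_sum
  have hp := pairRemove_length_and_sum l
  have hw : (wTuple l).Perm ((pairRemove l).2 ++ zList (pairRemove l).1) :=
    List.mergeSort_perm _ _
  rw [hw.length_eq, hw.sum_eq, List.length_append, List.sum_append]
  omega
end

section
/- Let k ≥ 1 and let w = (w_0, …, w_k) be a nondecreasing tuple of natural numbers. Define integer sequences β_i = (β_{i0}, β_{i1}, …) by β_{0j} = C(k−1+j, j) and β_{(i+1)j} = β_{ij} − β_{i(j−w_i−1)} for i = 0,…,k (with β_{it} := 0 when t < 0), and write B(w) = β_{k+1}. Then in the ring of formal power series ℤ[[t]] one has (Σ_{j≥0} B(w)_j t^j)·(1−t)^k = ∏_{i=0}^{k} (1 − t^{w_i+1}). -/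
/-- The multiplicity algorithm: `multAlg k w i j` is `β_{ij}`, where
`β_{0j} = C(k−1+j, j)` and `β_{(i+1)j} = β_{ij} − β_{i(j−wᵢ−1)}` (terms with a negative
index being `0`).  The output of the algorithm is `B(w) = β_{k+1}`. -/
def multAlg (k : ℕ) (w : ℕ → ℕ) : ℕ → ℕ → ℤ
  | 0, j => (Nat.choose (k - 1 + j) j : ℤ)
  | i + 1, j =>
      multAlg k w i j - if w i + 1 ≤ j then multAlg k w i (j - (w i + 1)) else 0

theorem mk_multAlg_zero_mul_one_sub_pow {k : ℕ} (hk : 0 < k) (w : ℕ → ℕ) :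
    (PowerSeries.mk fun j => multAlg k w 0 j) *
      (1 - (PowerSeries.X : PowerSeries ℤ)) ^ k = 1 := by
  have h : (PowerSeries.mk fun j => multAlg k w 0 j) =
      (PowerSeries.invOneSubPow ℤ k).val := by
    rw [PowerSeries.invOneSubPow_val_eq_mk_sub_one_add_choose_of_pos ℤ k hk]
    ext j
    simp only [PowerSeries.coeff_mk, multAlg, Nat.choose_symm_add]
  rw [h, ← PowerSeries.invOneSubPow_inv_eq_one_sub_pow]
  exact (PowerSeries.invOneSubPow ℤ k).val_inv

theorem mk_multAlg_succ (k : ℕ) (w : ℕ → ℕ) (i : ℕ) :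
    (PowerSeries.mk fun j => multAlg k w (i + 1) j) =
      (PowerSeries.mk fun j => multAlg k w i j) *
        (1 - (PowerSeries.X : PowerSeries ℤ) ^ (w i + 1)) := by
  ext j
  rw [mul_sub, mul_one, map_sub, PowerSeries.coeff_mul_X_pow']
  simp only [PowerSeries.coeff_mk, multAlg]

theorem mk_multAlg_mul_one_sub_pow {k : ℕ} (hk : 0 < k) (w : ℕ → ℕ) (n : ℕ) :
    (PowerSeries.mk fun j => multAlg k w n j) *
        (1 - (PowerSeries.X : PowerSeries ℤ)) ^ k =
      ∏ i ∈ Finset.range n, (1 - (PowerSeries.X : PowerSeries ℤ) ^ (w i + 1)) := by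
  induction n with
  | zero => rw [mk_multAlg_zero_mul_one_sub_pow hk, Finset.prod_range_zero]
  | succ n ih => rw [mk_multAlg_succ, mul_right_comm, ih, Finset.prod_range_succ]

/-- for `k ≥ 1` and a nondecreasing tuple `(w_0, …, w_k)`, the output
`B(w) = β_{k+1}` of the multiplicity algorithm satisfies
`(Σ_j B(w)_j t^j)·(1−t)^k = ∏_{i=0}^{k} (1 − t^{wᵢ+1})` in `ℤ[[t]]`. -/
theorem multAlg_generating_function (k : ℕ) (hk : 1 ≤ k) (w : ℕ → ℕ)
    (hw : ∀ i : ℕ, i < k → w i ≤ w (i + 1)) :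
    (PowerSeries.mk fun j => multAlg k w (k + 1) j) *
        (1 - (PowerSeries.X : PowerSeries ℤ)) ^ k =
      ∏ i ∈ Finset.range (k + 1), (1 - (PowerSeries.X : PowerSeries ℤ) ^ (w i + 1)) := by
  exact mk_multAlg_mul_one_sub_pow hk w (k + 1)
end

section
/- Let c = (c_{2k}, …, c_0) be an Sp-column sequence that contains a Kraft–Procesi chain, and let c♯ = (a_k, a_k, …, a_1, a_1, c_0) with a_i = (c_{2i}+c_{2i−1})/2. Let w = w(c) and x = w(c♯) be the nondecreasing (k+1)-tuples produced by the pair-removal algorithm. Then x ≠ w, and if m₀ is the least index at which they differ, then x_{m₀} < w_{m₀}. -/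
/-- A Kraft–Procesi chain in `(c_{2k}, …, c_0)`: indices `i ≥ j ≥ 1` with
`c_{2i} ≠ c_{2i−1} = c_{2i−2} = … = c_{2j−1} = c_{2j−2} ≠ c_{2j−3}` (where `c_{−1} := 0`,
which is the meaning of the `if j = 1` clause). -/
def HasKPChain (k : ℕ) (c : ℕ → ℕ) : Prop :=
  ∃ i j : ℕ, 1 ≤ j ∧ j ≤ i ∧ i ≤ k ∧
    c (2 * i) ≠ c (2 * i - 1) ∧
    (∀ t : ℕ, 2 * j - 2 ≤ t → t ≤ 2 * i - 1 → c t = c (2 * i - 1)) ∧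
    c (2 * j - 2) ≠ (if j = 1 then 0 else c (2 * j - 3))

/-- The values recorded by pair removal on `l`, followed by the averages of the consecutive
disjoint pairs of the entries it leaves. -/
def pairValues (l : List ℕ) : List ℕ :=
  (pairRemove l).2 ++ zPairs (pairRemove l).1

/-- `l` has even length and its consecutive disjoint pairs have even sum. -/
def EvenPairSums : List ℕ → Prop
  | [] => True
  | [_] => False
  | a :: b :: r => Even (a + b) ∧ EvenPairSums r

/-- `l` has a maximal constant run of even length, not at its end, starting at an odd
position. -/
def HasOddRun : List ℕ → Prop
  | a :: b :: r =>
      (a ≠ b ∧ ∃ n v s, b ≠ v ∧ r = List.replicate (2 * n + 1) b ++ v :: s) ∨ HasOddRun r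
  | _ => False

/-- `x` and `w` have the same length, and at the smallest value occurring with different
multiplicities, `x` has the larger multiplicity. -/
def CountDrop (x w : List ℕ) : Prop :=
  x.length = w.length ∧ ∃ t, w.count t < x.count t ∧ ∀ s < t, x.count s = w.count s

theorem CountDrop.cons {x w : List ℕ} (a : ℕ) (h : CountDrop x w) :
    CountDrop (a :: x) (a :: w) := by
  obtain ⟨hl, t, ht, hs⟩ := h
  refine ⟨by simp [hl], t, ?_, fun s hst => ?_⟩
  · simp only [List.count_cons]; omega
  · simp only [List.count_cons, hs s hst]

theorem CountDrop.of_cons {x w : List ℕ} {a : ℕ} (h : CountDrop (a :: x) (a :: w)) :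
    CountDrop x w := by
  obtain ⟨hl, t, ht, hs⟩ := h
  refine ⟨by simpa using hl, t, ?_, fun s hst => ?_⟩
  · simp only [List.count_cons] at ht; omega
  · have := hs s hst
    simp only [List.count_cons] at this; omega

theorem CountDrop.perm {x x' w w' : List ℕ} (h : CountDrop x w) (hx : x.Perm x')
    (hw : w.Perm w') : CountDrop x' w' := by
  obtain ⟨hl, t, ht, hs⟩ := h
  refine ⟨by rw [← hx.length_eq, ← hw.length_eq, hl], t, ?_, fun s hst => ?_⟩
  · rwa [← hx.count_eq, ← hw.count_eq]
  · rw [← hx.count_eq, ← hw.count_eq, hs s hst]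

theorem CountDrop.ne {x w : List ℕ} (h : CountDrop x w) : x ≠ w := by
  rintro rfl
  obtain ⟨-, t, ht, -⟩ := h
  exact lt_irrefl _ ht

theorem CountDrop.getD_lt : ∀ {x w : List ℕ}, CountDrop x w → x.Pairwise (· ≤ ·) →
    w.Pairwise (· ≤ ·) → ∀ m, (∀ i < m, x.getD i 0 = w.getD i 0) →
    x.getD m 0 ≠ w.getD m 0 → x.getD m 0 < w.getD m 0
  | [], w, h, _, _, m, _, _ => by
      obtain ⟨-, t, ht, -⟩ := h
      simp at ht
  | a :: x, [], h, _, _, m, _, _ => by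
      have := h.1
      simp at this
  | a :: x, b :: w, h, hx, hw, m, heq, hne => by
      rw [List.pairwise_cons] at hx hw
      have hab : a ≤ b := by
        by_contra! hlt
        obtain ⟨-, t, ht, hs⟩ := h
        have hmem : t ∈ a :: x := List.count_pos_iff.1 (by omega)
        have hat : a ≤ t := by
          rcases List.mem_cons.1 hmem with rfl | hm
          · exact le_rfl
          · exact hx.1 t hm
        have hb := hs b (by omega)
        have hbx : b ∈ a :: x := List.count_pos_iff.1 (by rw [hb]; simp)
        rcases List.mem_cons.1 hbx with rfl | hm
        · exact lt_irrefl _ hlt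
        · exact absurd (hx.1 b hm) (by omega)
      cases m with
      | zero =>
        simp only [List.getD_cons_zero] at hne ⊢
        omega
      | succ m =>
        have h0 := heq 0 (by omega)
        simp only [List.getD_cons_zero] at h0
        subst h0
        simp only [List.getD_cons_succ] at hne ⊢
        refine h.of_cons.getD_lt hx.2 hw.2 m (fun i hi => ?_) hne
        simpa using heq (i + 1) (by omega)

theorem length_pairRemove : ∀ l : List ℕ,
    (pairRemove l).1.length + 2 * (pairRemove l).2.length = l.length
  | [] => by simp [pairRemove]
  | [a] => by simp [pairRemove]
  | a :: b :: r => by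
      have h₁ := length_pairRemove r
      have h₂ := length_pairRemove (b :: r)
      simp only [List.length_cons] at h₂
      rw [pairRemove]
      split_ifs <;> simp only [List.length_cons] <;> omega

theorem mem_of_mem_pairRemove : ∀ (l : List ℕ) (y : ℕ),
    y ∈ (pairRemove l).1 ∨ y ∈ (pairRemove l).2 → y ∈ l
  | [], y => by simp [pairRemove]
  | [a], y => by simp [pairRemove]
  | a :: b :: r, y => by
      have h₁ := mem_of_mem_pairRemove r y
      have h₂ := mem_of_mem_pairRemove (b :: r) y
      rw [pairRemove]
      split_ifs <;> simp only [List.mem_cons] at h₂ ⊢ <;> tauto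

theorem length_zPairs : ∀ l : List ℕ, (zPairs l).length = (l.length + 1) / 2
  | [] => by simp [zPairs]
  | [a] => by simp [zPairs]
  | a :: b :: r => by
      have := length_zPairs r
      simp only [zPairs, List.length_cons]; omega

theorem le_of_mem_zPairs {t : ℕ} : ∀ l : List ℕ, Even l.length → (∀ y ∈ l, t ≤ y) →
    ∀ z ∈ zPairs l, t ≤ z
  | [], _, _ => by simp [zPairs]
  | [a], h, _ => by simp at h
  | a :: b :: r, h, ht => by
      have hr : Even r.length := by
        simp only [List.length_cons] at h
        grind
      intro z hz
      have ha := ht a (by simp)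
      have hb := ht b (by simp)
      rcases List.mem_cons.1 hz with rfl | hz
      · omega
      · exact le_of_mem_zPairs r hr (fun y hy => ht y (by simp [hy])) z hz

theorem EvenPairSums.even_length : ∀ {l : List ℕ}, EvenPairSums l → Even l.length
  | [], _ => by simp
  | [_], h => h.elim
  | a :: b :: r, h => by
      have := h.2.even_length
      simp only [List.length_cons]
      grind

theorem length_pairValues (l : List ℕ) : (pairValues l).length = (zPairs l).length := by
  have := length_pairRemove l
  simp only [pairValues, List.length_append, length_zPairs]
  omega

theorem pairValues_cons_cons_self (a : ℕ) (r : List ℕ) :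
    pairValues (a :: a :: r) = a :: pairValues r := by
  simp [pairValues, pairRemove]

theorem pairValues_cons_cons_perm {a b v : ℕ} (r : List ℕ) (hab : a ≠ b) (hbv : b ≠ v) :
    ((a + b) / 2 :: pairValues (v :: r)).Perm (pairValues (a :: b :: v :: r)) := by
  simp only [pairValues, pairRemove, hab, hbv, if_false, zPairs]
  exact List.perm_middle.symm

theorem pairValues_cons_triple {a b : ℕ} (r : List ℕ) (hab : a ≠ b) :
    pairValues (a :: b :: b :: b :: r) = b :: pairValues (a :: b :: r) := by
  simp [pairValues, pairRemove, hab]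

theorem countDrop_of_gap {a b v : ℕ} {r : List ℕ} (hab : a < b) (hbv : b < v)
    (hr : ∀ y ∈ r, v ≤ y) (hlen : Even r.length) (h₁ : Even (a + b)) (h₂ : Even (b + v)) :
    CountDrop (zPairs (a :: b :: b :: v :: r)) (pairValues (a :: b :: b :: v :: r)) := by
  have hvr : ∀ y ∈ v :: r, v ≤ y := by simpa using hr
  have hW : ∀ z ∈ pairValues (a :: b :: b :: v :: r), (a + b) / 2 < z := by
    have hd := length_pairRemove (v :: r)
    have hd₁ : ∀ y ∈ (pairRemove (v :: r)).1, v ≤ y := fun y hy =>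
      hvr y (mem_of_mem_pairRemove _ y (.inl hy))
    have hd₂ : ∀ y ∈ (pairRemove (v :: r)).2, v ≤ y := fun y hy =>
      hvr y (mem_of_mem_pairRemove _ y (.inr hy))
    simp only [pairValues, pairRemove, hab.ne, if_true, if_false]
    generalize pairRemove (v :: r) = p at hd hd₁ hd₂ ⊢
    obtain ⟨d, Y⟩ := p
    simp only [List.length_cons] at hd hd₁ hd₂
    cases d with
    | nil => simp only [List.length_nil] at hd; grind
    | cons d₀ d =>
      intro z hz
      have hv := hd₁ d₀ (by simp)
      simp only [zPairs, List.cons_append, List.mem_cons, List.mem_append] at hz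
      rcases hz with rfl | hz | rfl | hz
      · omega
      · have := hd₂ z hz
        omega
      · grind
      · have hde : Even d.length := by
          simp only [List.length_cons] at hd
          grind
        have := le_of_mem_zPairs d hde (fun y hy => hd₁ y (by simp [hy])) z hz
        omega
  refine ⟨(length_pairValues _).symm, (a + b) / 2, ?_, fun s hs => ?_⟩
  · rw [List.count_eq_zero_of_not_mem fun h => lt_irrefl _ (hW _ h)]
    simp [zPairs]
  · rw [List.count_eq_zero_of_not_mem fun h => absurd (hW _ h) (by omega),
      List.count_eq_zero_of_not_mem]
    simp only [zPairs, List.mem_cons]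
    rintro (rfl | rfl | h)
    · omega
    · omega
    · have := le_of_mem_zPairs r hlen hr s h
      omega

theorem countDrop_zPairs_pairValues : ∀ l : List ℕ, l.Pairwise (· ≤ ·) → EvenPairSums l →
    HasOddRun l → CountDrop (zPairs l) (pairValues l)
  | [], _, _, h => h.elim
  | [_], _, _, h => h.elim
  | [a, b], _, _, h => by simp [HasOddRun] at h
  | [a, b, c], _, he, _ => he.2.elim
  | a :: b :: v :: v' :: r, hl, he, hrun => by
      by_cases hab : a = b
      · subst hab
        have hrun' : HasOddRun (v :: v' :: r) := by
          rw [HasOddRun] at hrun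
          simpa using hrun
        rw [pairValues_cons_cons_self]
        have := (countDrop_zPairs_pairValues (v :: v' :: r)
          (hl.sublist (by simp)) he.2 hrun').cons a
        rw [zPairs, show (a + a) / 2 = a by omega]
        exact this
      by_cases hbv : b = v
      · subst hbv
        by_cases hbv' : b = v'
        · subst hbv'
          have hrun' : HasOddRun (a :: b :: r) := by
            rcases hrun with ⟨-, n, u, s, hbu, hs⟩ | hrun
            · left
              refine ⟨hab, ?_⟩
              cases n with
              | zero => simp at hs; exact absurd hs.1 hbu
              | succ n =>
                refine ⟨n, u, s, hbu, ?_⟩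
                simpa [show 2 * (n + 1) + 1 = (2 * n + 1) + 1 + 1 by ring,
                  List.replicate_succ (n := 2 * n + 1 + 1),
                  List.replicate_succ (n := 2 * n + 1)] using hs
            · rcases hrun with ⟨h, -⟩ | hrun
              · exact absurd rfl h
              · exact .inr hrun
          rw [pairValues_cons_triple r hab]
          have := (countDrop_zPairs_pairValues (a :: b :: r)
            (hl.sublist (by simp)) ⟨he.1, he.2.2⟩ hrun').cons b
          refine this.perm ?_ (List.Perm.refl _)
          simp only [zPairs, show (b + b) / 2 = b by omega]
          exact List.Perm.swap _ _ _
        · simp only [List.pairwise_cons, List.mem_cons, forall_eq_or_imp] at hl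
          exact countDrop_of_gap (by omega) (by omega) hl.2.2.2.1 he.2.2.even_length he.1 he.2.1
      · have hrun' : HasOddRun (v :: v' :: r) := by
          rcases hrun with ⟨-, n, u, s, -, hs⟩ | hrun
          · simp only [List.replicate_succ, List.cons_append, List.cons.injEq] at hs
            exact absurd hs.1.symm hbv
          · exact hrun
        exact ((countDrop_zPairs_pairValues (v :: v' :: r) (hl.sublist (by simp)) he.2
          hrun').cons _).perm (List.Perm.refl _) (pairValues_cons_cons_perm _ hab hbv)
termination_by l => l.length

theorem perm_pairValues_zero_cons : ∀ l : List ℕ, Odd l.length →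
    ((pairRemove l).2 ++ zList (pairRemove l).1).Perm (pairValues (0 :: l))
  | [], h => by simp at h
  | [a], _ => by
      by_cases ha : 0 = a
      · subst ha; simp [pairValues, pairRemove, zList, zPairs]
      · simp [pairValues, pairRemove, zList, zPairs, ha]
  | a :: b :: r, h => by
      by_cases ha : 0 = a
      · subst ha
        by_cases hb : 0 = b
        · subst hb
          have hr : Odd r.length := by simp only [List.length_cons] at h; grind
          rw [pairValues_cons_cons_self]
          simpa [pairRemove] using perm_pairValues_zero_cons r hr
        · simp only [pairValues, pairRemove, hb, if_true, if_false, zList]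
          exact List.perm_middle
      · have hd := length_pairRemove (a :: b :: r)
        have hcons : pairRemove (0 :: a :: b :: r) =
            (0 :: (pairRemove (a :: b :: r)).1, (pairRemove (a :: b :: r)).2) := by
          rw [pairRemove, if_neg ha]
        rw [pairValues, hcons]
        cases hp : (pairRemove (a :: b :: r)).1 with
        | nil => simp only [hp, List.length_nil] at hd; grind
        | cons d₀ d => simp [zList, zPairs]

theorem pairRemove_cons_doubles (a : ℕ) : ∀ l : List ℕ,
    pairRemove (a :: l.flatMap fun b => [b, b]) = ([a], l)
  | [] => by simp [pairRemove]
  | b :: l => by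
      have hd : ∀ l : List ℕ, pairRemove (l.flatMap fun b => [b, b]) = ([], l) := by
        intro l
        induction l with
        | nil => simp [pairRemove]
        | cons b l ih => simp [pairRemove, ih]
      have ih := pairRemove_cons_doubles a l
      have hd' := hd (b :: l)
      simp only [List.flatMap_cons, List.cons_append, List.nil_append] at hd' ⊢
      rw [pairRemove]
      split_ifs with h
      · subst h; simp [ih]
      · simp [hd']

theorem map_range_two_mul_add_one (f : ℕ → ℕ) (k : ℕ) :
    (List.range (2 * k + 1)).map f =
      f 0 :: (List.range k).flatMap fun i => [f (2 * i + 1), f (2 * i + 2)] := by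
  induction k with
  | zero => simp
  | succ k ih =>
    rw [show 2 * (k + 1) + 1 = (2 * k + 1) + 1 + 1 by ring, List.range_succ, List.range_succ,
      List.map_append, List.map_append, ih, List.range_succ]
    simp

theorem zPairs_flatMap (f g : ℕ → ℕ) (l : List ℕ) :
    zPairs (l.flatMap fun i => [f i, g i]) = l.map fun i => (f i + g i) / 2 := by
  induction l with
  | nil => simp [zPairs]
  | cons a l ih => simp [zPairs, ih]

theorem EvenPairSums.flatMap (f g : ℕ → ℕ) (l : List ℕ) (h : ∀ i ∈ l, Even (f i + g i)) :
    EvenPairSums (l.flatMap fun i => [f i, g i]) := by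
  induction l with
  | nil => simp [EvenPairSums]
  | cons a l ih =>
    simp only [List.flatMap_cons, List.cons_append, List.nil_append]
    exact ⟨h a (by simp), ih fun i hi => h i (by simp [hi])⟩

theorem HasOddRun.of_drop {l : List ℕ} (p : ℕ) (h : HasOddRun (l.drop (2 * p))) :
    HasOddRun l := by
  induction p generalizing l with
  | zero => simpa using h
  | succ p ih =>
    match l with
    | [] => simp [HasOddRun] at h
    | [a] => simp [Nat.mul_succ, HasOddRun] at h
    | a :: b :: r => exact .inr (ih (by simpa [Nat.mul_succ] using h))

theorem hasOddRun_map_range (f : ℕ → ℕ) (p n N : ℕ) (hN : 2 * p + 2 * n + 3 < N)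
    (h₀ : f (2 * p) ≠ f (2 * p + 1))
    (hrun : ∀ t, 2 * p + 1 ≤ t → t ≤ 2 * p + 2 * n + 2 → f t = f (2 * p + 1))
    (h₁ : f (2 * p + 1) ≠ f (2 * p + 2 * n + 3)) :
    HasOddRun ((List.range N).map f) := by
  obtain ⟨m, rfl⟩ : ∃ m, N = 2 * p + (1 + (1 + ((2 * n + 1) + (1 + m)))) :=
    ⟨N - (2 * p + 2 * n + 4), by omega⟩
  refine HasOddRun.of_drop p ?_
  have hrep : (List.range (2 * n + 1)).map (fun t => f (2 * p + (1 + (1 + t)))) =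
      List.replicate (2 * n + 1) (f (2 * p + 1)) := by
    rw [List.eq_replicate_iff]
    refine ⟨by simp, ?_⟩
    simp only [List.mem_map, List.mem_range]
    rintro _ ⟨t, ht, rfl⟩
    exact hrun _ (by omega) (by omega)
  have hlist : ((List.range (2 * p + (1 + (1 + ((2 * n + 1) + (1 + m)))))).map f).drop (2 * p) =
      f (2 * p) :: f (2 * p + 1) :: (List.replicate (2 * n + 1) (f (2 * p + 1)) ++
        f (2 * p + 2 * n + 3) ::
          (List.range m).map fun t => f (2 * p + (1 + (1 + (2 * n + 1 + (1 + t)))))) := by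
    rw [List.range_add, List.map_append, List.drop_left' (by simp), List.range_add,
      List.range_add, List.range_add (n := 2 * n + 1), List.range_add (n := 1) (m := m), ← hrep,
      show 2 * p + 2 * n + 3 = 2 * p + (1 + (1 + (2 * n + 1))) by ring]
    generalize 2 * n + 1 = q
    simp [Function.comp_def]
  rw [hlist]
  exact .inl ⟨h₀, n, _, _, h₁, rfl⟩

/-- if the Sp-column sequence `c` contains a Kraft–Procesi chain, then the
tuples `x = w(c♯)` and `w = w(c)` differ, and at the least index `m₀` where they differ one
has `x_{m₀} < w_{m₀}`. -/
theorem wTuple_spSharp_drops (k : ℕ) (c : ℕ → ℕ) (hc : IsSpColumnSeq k c)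
    (hchain : HasKPChain k c) :
    wTuple ((List.range (2 * k + 1)).map (spSharp c)) ≠
      wTuple ((List.range (2 * k + 1)).map c) ∧
    ∀ m₀ : ℕ,
      (∀ i : ℕ, i < m₀ →
        (wTuple ((List.range (2 * k + 1)).map (spSharp c))).getD i 0 =
          (wTuple ((List.range (2 * k + 1)).map c)).getD i 0) →
      (wTuple ((List.range (2 * k + 1)).map (spSharp c))).getD m₀ 0 ≠
        (wTuple ((List.range (2 * k + 1)).map c)).getD m₀ 0 →
      (wTuple ((List.range (2 * k + 1)).map (spSharp c))).getD m₀ 0 <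
        (wTuple ((List.range (2 * k + 1)).map c)).getD m₀ 0 := by
  obtain ⟨hmono, hc₀, heven⟩ := hc
  set f : ℕ → ℕ := fun n => if n = 0 then 0 else c (n - 1) with hf
  have hfl : (List.range (2 * k + 2)).map f = 0 :: (List.range (2 * k + 1)).map c := by
    rw [List.range_succ_eq_map]
    simp [hf, Function.comp_def]
  set l := (List.range k).map fun i => (c (2 * i + 1) + c (2 * i + 2)) / 2 with hl
  have hsharp : (List.range (2 * k + 1)).map (spSharp c) = c 0 :: l.flatMap fun b => [b, b] := by
    rw [map_range_two_mul_add_one, hl, List.flatMap_map]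
    congr 2
    funext i
    simp only [spSharp, show (2 * i + 1 + 1) / 2 = i + 1 by omega,
      show (2 * i + 2 + 1) / 2 = i + 1 by omega, show 2 * (i + 1) = 2 * i + 2 by ring]
    simp [add_comm (c (2 * i + 1))]
  have hz : zPairs ((List.range (2 * k + 2)).map f) = c 0 / 2 :: l := by
    rw [hfl, map_range_two_mul_add_one, zPairs, zPairs_flatMap, zero_add]
  have hx : (zPairs ((List.range (2 * k + 2)).map f)).Perm
      (wTuple ((List.range (2 * k + 1)).map (spSharp c))) := by
    rw [hz, hsharp, wTuple, pairRemove_cons_doubles]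
    refine List.Perm.trans ?_ (List.mergeSort_perm _ _).symm
    simpa [zList, zPairs] using (List.perm_append_singleton (c 0 / 2) l).symm
  have hw : (pairValues ((List.range (2 * k + 2)).map f)).Perm
      (wTuple ((List.range (2 * k + 1)).map c)) := by
    rw [hfl, wTuple]
    exact (perm_pairValues_zero_cons _ (by simp)).symm.trans (List.mergeSort_perm _ _).symm
  have hsorted : ((List.range (2 * k + 2)).map f).Pairwise (· ≤ ·) := by
    have hcm : ∀ i j, i ≤ j → j ≤ 2 * k → c i ≤ c j := by
      intro i j hij
      induction j, hij using Nat.le_induction with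
      | base => intro _; exact le_rfl
      | succ j hij ih => intro hj; exact (ih (by omega)).trans (hmono j (by omega))
    rw [hfl, List.pairwise_cons]
    refine ⟨by simp, ?_⟩
    rw [List.pairwise_map]
    refine List.pairwise_lt_range.imp_of_mem fun {i j} _ hj hij => ?_
    exact hcm i j hij.le (by simp at hj; omega)
  have hpairs : EvenPairSums ((List.range (2 * k + 2)).map f) := by
    rw [hfl, map_range_two_mul_add_one]
    refine ⟨by simpa using hc₀, EvenPairSums.flatMap _ _ _ fun i hi => ?_⟩
    have := heven (i + 1) (by omega) (by simp at hi; omega)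
    rwa [show 2 * (i + 1) - 1 = 2 * i + 1 by omega, show 2 * (i + 1) = 2 * i + 2 by ring,
      add_comm] at this
  have hrun : HasOddRun ((List.range (2 * k + 2)).map f) := by
    obtain ⟨i, j, hj, hji, hik, h₁, hconst, h₂⟩ := hchain
    have hstart : f (2 * (j - 1) + 1) = c (2 * i - 1) := by
      simp only [hf, Nat.add_eq_zero_iff, one_ne_zero, and_false, if_false]
      exact hconst _ (by omega) (by omega)
    refine hasOddRun_map_range f (j - 1) (i - j) _ (by omega) ?_ ?_ ?_
    · rw [hstart, ← hconst (2 * j - 2) le_rfl (by omega)]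
      by_cases hj₁ : j = 1
      · subst hj₁
        simpa [hf] using h₂.symm
      · rw [if_neg hj₁] at h₂
        simp only [hf]
        rw [if_neg (by omega), show 2 * (j - 1) - 1 = 2 * j - 3 by omega]
        exact h₂.symm
    · intro t ht ht'
      rw [hstart]
      simp only [hf]
      rw [if_neg (by omega)]
      exact hconst _ (by omega) (by omega)
    · rw [hstart]
      simp only [hf]
      rw [if_neg (by omega), show 2 * (j - 1) + 2 * (i - j) + 3 - 1 = 2 * i by omega]
      exact h₁.symm
  have hdrop := (countDrop_zPairs_pairValues _ hsorted hpairs hrun).perm hx hw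
  have hsort : ∀ a, (wTuple a).Pairwise (· ≤ ·) := fun a => by
    simpa [wTuple] using List.pairwise_mergeSort (le := fun a b : ℕ => decide (a ≤ b))
      (by simpa using fun a b c => le_trans) (by simpa using le_total) _
  exact ⟨hdrop.ne, hdrop.getD_lt (hsort _) (hsort _)⟩
end
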